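/- Under Assumptions 1–4, with each expert E_i being an instance of SOGD (parameters δ > 0, α = D/√2) started at round i and combined by the SACS meta-algorithm over the CGC intervals, for any interval [i, j] ∈ 𝒞, any t ∈ [i, j], and any w ∈ W: Σ_{u=i}^t [f_u(w_u) − f_u(w)] ≤ a(t) + √(b(t) Σ_{u=i}^t f_u(w)), where a(t) = (9/2) ln(4t²) + 18 H D² + 2D√(2δ) and b(t) = 24 ln(4t²) + 16 H D². -/

import Mathlib

/-- The AdaNormalHedge potential: `Φ(R, C) = exp([R]₊²/(3C))` for `C > 0` and `Φ(R, 0) = 1`. -/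
noncomputable def anhPhi (R C : ℝ) : ℝ :=
  if 0 < C then Real.exp (max R 0 ^ 2 / (3 * C)) else 1

/-- The AdaNormalHedge weight: `w(R, C) = (Φ(R+1, C+1) − Φ(R−1, C+1))/2`. -/
noncomputable def anhWeight (R C : ℝ) : ℝ :=
  (anhPhi (R + 1) (C + 1) - anhPhi (R - 1) (C + 1)) / 2

/-- The right endpoint `e i` of the unique compact geometric covering (CGC) interval
`[i, e i] ∈ 𝒞` with left endpoint `i ≥ 1`. -/
def cgcEnd (i : ℕ) : ℕ := i + 2 ^ padicValNat 2 i - 1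

/-- The active set `S t = { i : i ≤ t ≤ e i }` of experts at round `t`. -/
def activeSet (t : ℕ) : Finset ℕ := (Finset.Icc 1 t).filter fun i => t ≤ cgcEnd i

theorem anhPhi_nonneg (R C : ℝ) : 0 ≤ anhPhi R C := by
  unfold anhPhi; split_ifs <;> positivity

theorem anhPhi_le_anhPhi {R R' C : ℝ} (h : R ≤ R') : anhPhi R C ≤ anhPhi R' C := by
  unfold anhPhi
  split_ifs with hC
  · gcongr
  · rfl

theorem anhWeight_nonneg (R C : ℝ) : 0 ≤ anhWeight R C := by
  have := anhPhi_le_anhPhi (C := C + 1) (show R - 1 ≤ R + 1 by linarith)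
  unfold anhWeight
  linarith

theorem anhPhi_zero_zero : anhPhi 0 0 = 1 := by simp [anhPhi]

theorem anhWeight_zero_zero : anhWeight 0 0 = (Real.exp (1 / 3) - 1) / 2 := by
  norm_num [anhWeight, anhPhi]

theorem anhWeight_zero_zero_pos : 0 < anhWeight 0 0 := by
  rw [anhWeight_zero_zero]
  have := Real.add_one_lt_exp (show (1 / 3 : ℝ) ≠ 0 by norm_num)
  linarith

theorem sq_max_div_le {R R' C C' r : ℝ} (hC : 0 < C) (hC' : 0 < C') (hr0 : 0 ≤ r) (hr1 : r ≤ 1) :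
    max ((1 - r) * R + r * R') 0 ^ 2 / (3 * ((1 - r) * C + r * C')) ≤
      (1 - r) * (max R 0 ^ 2 / (3 * C)) + r * (max R' 0 ^ 2 / (3 * C')) := by
  set a := max R 0
  set b := max R' 0
  have ha : 0 ≤ a := le_max_right _ _
  have hb : 0 ≤ b := le_max_right _ _
  have h1r : 0 ≤ 1 - r := by linarith
  have hm : max ((1 - r) * R + r * R') 0 ≤ (1 - r) * a + r * b := by
    refine max_le ?_ (by positivity)
    gcongr
    · exact le_max_left _ _
    · exact le_max_left _ _
  have hden : 0 < (1 - r) * C + r * C' := by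
    rcases hr0.eq_or_lt with h | h
    · subst h; simpa using hC
    · positivity
  have hsq : max ((1 - r) * R + r * R') 0 ^ 2 ≤ ((1 - r) * a + r * b) ^ 2 := by
    gcongr
  rw [div_le_iff₀ (by positivity)]
  refine hsq.trans ?_
  have key : ((1 - r) * (a ^ 2 / (3 * C)) + r * (b ^ 2 / (3 * C'))) *
      (3 * ((1 - r) * C + r * C')) - ((1 - r) * a + r * b) ^ 2 =
      (1 - r) * r * (a * C' - b * C) ^ 2 / (C * C') := by
    field_simp
    ring
  have : 0 ≤ (1 - r) * r * (a * C' - b * C) ^ 2 / (C * C') := by positivity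
  linarith

theorem anhPhi_convex_comb_le {R R' C C' r : ℝ} (hC : 0 < C) (hC' : 0 < C') (hr0 : 0 ≤ r)
    (hr1 : r ≤ 1) :
    anhPhi ((1 - r) * R + r * R') ((1 - r) * C + r * C') ≤
      (1 - r) * anhPhi R C + r * anhPhi R' C' := by
  have hden : 0 < (1 - r) * C + r * C' := by
    rcases hr0.eq_or_lt with h | h
    · subst h; simpa using hC
    · have : 0 ≤ 1 - r := by linarith
      positivity
  simp only [anhPhi, hC, hC', hden, if_true]
  refine (Real.exp_le_exp.2 (sq_max_div_le hC hC' hr0 hr1)).trans ?_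
  have := convexOn_exp.2 (Set.mem_univ (max R 0 ^ 2 / (3 * C)))
    (Set.mem_univ (max R' 0 ^ 2 / (3 * C'))) (sub_nonneg.2 hr1) hr0 (by ring)
  simpa [smul_eq_mul] using this

theorem anhPhi_average_le {R C : ℝ} (hC : 0 < C) :
    (anhPhi (R + 1) (C + 1) + anhPhi (R - 1) (C + 1)) / 2 ≤ anhPhi R C + 3 := by
  have hC1 : 0 < C + 1 := by linarith
  have he := Real.exp_one_lt_d9
  have hpos := anhPhi_nonneg R C
  rcases le_total R 0 with hR | hR
  · have h1 : anhPhi (R + 1) (C + 1) ≤ Real.exp 1 := by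
      simp only [anhPhi, hC1, if_true]
      refine Real.exp_le_exp.2 ?_
      rw [div_le_one (by positivity)]
      have h0 : 0 ≤ max (R + 1) 0 := le_max_right _ _
      have h2 : max (R + 1) 0 ≤ 1 := max_le (by linarith) (by norm_num)
      nlinarith
    have h2 := anhPhi_le_anhPhi (C := C + 1) (show R - 1 ≤ R + 1 by linarith)
    linarith
  · have hbound : ∀ S : ℝ, anhPhi S (C + 1) ≤ Real.exp (S ^ 2 / (3 * (C + 1))) := by
      intro S
      simp only [anhPhi, hC1, if_true]
      refine Real.exp_le_exp.2 ?_
      gcongr ?_ / _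
      rcases le_total S 0 with h | h
      · simpa [h] using sq_nonneg S
      · simp [h]
    have hcosh : (Real.exp ((R + 1) ^ 2 / (3 * (C + 1))) +
        Real.exp ((R - 1) ^ 2 / (3 * (C + 1)))) / 2 ≤
        Real.exp ((R ^ 2 + 1) / (3 * (C + 1)) + (2 * R / (3 * (C + 1))) ^ 2 / 2) := by
      have h := Real.cosh_le_exp_half_sq (2 * R / (3 * (C + 1)))
      rw [Real.exp_add]
      refine le_trans (le_of_eq ?_)
        (mul_le_mul_of_nonneg_left h (Real.exp_pos _).le)
      rw [Real.cosh_eq, mul_div_assoc', mul_add (Real.exp _), ← Real.exp_add, ← Real.exp_add]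
      congr 3 <;> field_simp <;> ring
    set y := R ^ 2 / (3 * C) with hy
    have hRy : R ^ 2 = 3 * C * y := by rw [hy]; field_simp
    have hy0 : 0 ≤ y := by positivity
    have hexp : (R ^ 2 + 1) / (3 * (C + 1)) + (2 * R / (3 * (C + 1))) ^ 2 / 2 ≤
        y + (1 - y) / (3 * (C + 1)) := by
      rw [div_pow, mul_pow, hRy, ← sub_nonneg]
      have : y + (1 - y) / (3 * (C + 1)) - ((3 * C * y + 1) / (3 * (C + 1)) +
          2 ^ 2 * (3 * C * y) / (3 * (C + 1)) ^ 2 / 2) = 2 * y / (3 * (C + 1) ^ 2) := by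
        field_simp
        ring
      rw [this]
      positivity
    have hphi : anhPhi R C = Real.exp y := by
      simp [anhPhi, hC, hR, hy]
    have hmax : Real.exp (y + (1 - y) / (3 * (C + 1))) ≤ anhPhi R C + 3 := by
      rcases le_total 1 y with h1 | h1
      · rw [hphi]
        have : (1 - y) / (3 * (C + 1)) ≤ 0 :=
          div_nonpos_of_nonpos_of_nonneg (by linarith) (by positivity)
        have := Real.exp_le_exp.2 (show y + (1 - y) / (3 * (C + 1)) ≤ y by linarith)
        linarith
      · have : (1 - y) / (3 * (C + 1)) ≤ 1 - y :=
          div_le_self (by linarith) (by linarith)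
        have := Real.exp_le_exp.2 (show y + (1 - y) / (3 * (C + 1)) ≤ 1 by linarith)
        linarith
    have h1 := hbound (R + 1)
    have h2 := hbound (R - 1)
    have h3 := Real.exp_le_exp.2 hexp
    linarith

theorem anhPhi_add_le {R C r : ℝ} (hRC : |R| ≤ C) (hr : |r| ≤ 1) :
    anhPhi (R + r) (C + |r|) ≤ anhPhi R C + anhWeight R C * r + 3 := by
  have hC0 : 0 ≤ C := (abs_nonneg R).trans hRC
  obtain ⟨hr1, hr2⟩ := abs_le.1 hr
  rcases hC0.eq_or_lt with hC | hC
  · subst hC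
    have hR : R = 0 := abs_nonpos_iff.1 hRC
    subst hR
    have he := Real.exp_one_lt_d9
    have hphi : anhPhi (0 + r) (0 + |r|) ≤ Real.exp 1 := by
      unfold anhPhi
      split_ifs with h
      · refine Real.exp_le_exp.2 ?_
        rw [zero_add, zero_add] at *
        rw [div_le_one (by positivity)]
        have h0 : 0 ≤ max r 0 := le_max_right _ _
        have h1 : max r 0 ≤ |r| := max_le (le_abs_self r) (abs_nonneg r)
        nlinarith
      · exact Real.one_le_exp zero_le_one
    have hw : anhWeight 0 0 ≤ 1 := by
      have h1 : Real.exp (1 / 3) ≤ Real.exp 1 := Real.exp_le_exp.2 (by norm_num)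
      rw [anhWeight_zero_zero]
      linarith
    have hw0 := anhWeight_nonneg 0 0
    rw [anhPhi_zero_zero]
    nlinarith
  · have havg := anhPhi_average_le (R := R) hC
    have hC1 : 0 < C + 1 := by linarith
    rcases le_total 0 r with h | h
    · have hc := anhPhi_convex_comb_le (R := R) (R' := R + 1) hC hC1 h hr2
      rw [abs_of_nonneg h]
      rw [show (1 - r) * R + r * (R + 1) = R + r by ring,
        show (1 - r) * C + r * (C + 1) = C + r by ring] at hc
      unfold anhWeight
      nlinarith
    · have hc := anhPhi_convex_comb_le (R := R) (R' := R - 1) (r := -r) hC hC1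
        (by linarith) (by linarith)
      rw [abs_of_nonpos h]
      rw [show (1 - -r) * R + -r * (R - 1) = R + r by ring,
        show (1 - -r) * C + -r * (C + 1) = C + -r by ring] at hc
      unfold anhWeight
      nlinarith

section Optimization

variable {E : Type*} [NormedAddCommGroup E] [InnerProductSpace ℝ E]

theorem ConvexOn.add_inner_gradient_le [CompleteSpace E] {f : E → ℝ}
    (hf : ConvexOn ℝ Set.univ f) {x : E} (hd : DifferentiableAt ℝ f x) (y : E) :
    f x + inner ℝ (gradient f x) (y - x) ≤ f y := by
  have hline : ConvexOn ℝ Set.univ (f ∘ AffineMap.lineMap (k := ℝ) x y) := by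
    simpa using hf.comp_affineMap (AffineMap.lineMap (k := ℝ) x y)
  have hderiv : HasDerivAt (f ∘ AffineMap.lineMap (k := ℝ) x y)
      (inner ℝ (gradient f x) (y - x)) 0 := by
    have h1 : HasFDerivAt f (fderiv ℝ f x) (AffineMap.lineMap (k := ℝ) x y 0) := by
      simpa using hd.hasFDerivAt
    rw [inner_gradient_left]
    exact h1.comp_hasDerivAt (0 : ℝ) AffineMap.hasDerivAt_lineMap
  have := hline.le_slope_of_hasDerivAt (Set.mem_univ 0) (Set.mem_univ 1) zero_lt_one hderiv
  simp only [slope_def_field, Function.comp_apply, AffineMap.lineMap_apply_one,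
    AffineMap.lineMap_apply_zero, sub_zero, div_one] at this
  linarith

/-- A nonnegative convex function with `H`-Lipschitz gradient is self-bounding. -/
theorem ConvexOn.norm_gradient_sq_le [CompleteSpace E] {f : E → ℝ}
    (hf : ConvexOn ℝ Set.univ f) (hd : Differentiable ℝ f) (hf0 : ∀ x, 0 ≤ f x) {H : ℝ}
    (hH : 0 ≤ H) (hsmooth : ∀ x y, ‖gradient f x - gradient f y‖ ≤ H * ‖x - y‖) (x : E) :
    ‖gradient f x‖ ^ 2 ≤ 4 * H * f x := by
  set g := gradient f x with hg
  have key : ∀ s : ℝ, 0 ≤ s → s * ‖g‖ ^ 2 ≤ f x + H * s ^ 2 * ‖g‖ ^ 2 := by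
    intro s hs
    have h1 := hf.add_inner_gradient_le (hd (x - s • g)) x
    have h0 := hf0 (x - s • g)
    have h2 : inner ℝ (g - gradient f (x - s • g)) (s • g) ≤ H * s ^ 2 * ‖g‖ ^ 2 := by
      refine (real_inner_le_norm _ _).trans ?_
      have h3 := hsmooth x (x - s • g)
      rw [sub_sub_cancel] at h3
      calc _ ≤ H * ‖s • g‖ * ‖s • g‖ := by gcongr
        _ = _ := by rw [norm_smul, Real.norm_of_nonneg hs]; ring
    rw [sub_sub_cancel] at h1
    rw [inner_sub_left, real_inner_smul_right, real_inner_self_eq_norm_sq] at h2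
    linarith
  rcases hH.eq_or_lt with h | h
  · subst h
    by_contra! hc
    have hpos : 0 < ‖g‖ ^ 2 := by simpa using hc
    have := key ((f x + 1) / ‖g‖ ^ 2) (div_nonneg (by linarith [hf0 x]) hpos.le)
    rw [div_mul_cancel₀ _ hpos.ne'] at this
    linarith
  · have := key (1 / (2 * H)) (by positivity)
    field_simp at this
    linarith

theorem norm_proj_sub_sq_le {W : Set E} (hW : Convex ℝ W) {z P : E}
    (hP : P ∈ W ∧ ∀ y ∈ W, ‖z - P‖ ≤ ‖z - y‖) {x : E} (hx : x ∈ W) :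
    ‖P - x‖ ^ 2 ≤ ‖z - x‖ ^ 2 := by
  have : Nonempty W := ⟨⟨x, hx⟩⟩
  have hinf : ‖z - P‖ = ⨅ w : W, ‖z - w‖ :=
    le_antisymm (le_ciInf fun w => hP.2 w w.2)
      (ciInf_le (f := fun w : W => ‖z - w‖) ⟨0, by rintro _ ⟨w, rfl⟩; positivity⟩ ⟨P, hP.1⟩)
  have h := (norm_eq_iInf_iff_real_inner_le_zero hW hP.1).1 hinf x hx
  have hz : z - x = (z - P) - (x - P) := by abel
  rw [hz, norm_sub_sq_real (z - P), norm_sub_rev P x]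
  nlinarith [sq_nonneg ‖z - P‖]

/-- Linearized regret of scale-free online gradient descent, multiplied by the parameter `α`. -/
theorem mul_sum_inner_le_of_scaleFree_ogd {W : Set E} (hW : Convex ℝ W) {proj : E → E}
    (hproj : ∀ x : E, proj x ∈ W ∧ ∀ y ∈ W, ‖x - proj x‖ ≤ ‖x - y‖) {D : ℝ}
    (hdiam : ∀ x ∈ W, ∀ y ∈ W, ‖x - y‖ ≤ D) {δ α : ℝ} (hδ : 0 < δ) (hα : α ^ 2 = D ^ 2 / 2)
    {w g : ℕ → E} (hw : ∀ n, w n ∈ W)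
    (hrec : ∀ n, w (n + 1) =
      proj (w n - (α / √(δ + ∑ k ∈ Finset.range (n + 1), ‖g k‖ ^ 2)) • g n))
    {x : E} (hx : x ∈ W) (n : ℕ) :
    α * ∑ k ∈ Finset.range n, inner ℝ (g k) (w k - x) ≤
      D ^ 2 * √(δ + ∑ k ∈ Finset.range n, ‖g k‖ ^ 2) := by
  have hd : ∀ n, ‖w n - x‖ ^ 2 ≤ D ^ 2 := fun n =>
    pow_le_pow_left₀ (norm_nonneg _) (hdiam _ (hw n) _ hx) 2
  suffices h : α * ∑ k ∈ Finset.range n, inner ℝ (g k) (w k - x) +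
      √(δ + ∑ k ∈ Finset.range n, ‖g k‖ ^ 2) * ‖w n - x‖ ^ 2 / 2 ≤
      D ^ 2 * √(δ + ∑ k ∈ Finset.range n, ‖g k‖ ^ 2) by
    have : 0 ≤ √(δ + ∑ k ∈ Finset.range n, ‖g k‖ ^ 2) * ‖w n - x‖ ^ 2 / 2 := by positivity
    linarith
  induction n with
  | zero =>
    simp only [Finset.range_zero, Finset.sum_empty, mul_zero, add_zero, zero_add]
    nlinarith [hd 0, Real.sqrt_nonneg δ, sq_nonneg D, mul_le_mul_of_nonneg_left (hd 0)
      (Real.sqrt_nonneg δ), mul_nonneg (sq_nonneg D) (Real.sqrt_nonneg δ)]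
  | succ n ih =>
    have hstep := norm_proj_sub_sq_le hW
      (hproj (w n - (α / √(δ + ∑ k ∈ Finset.range (n + 1), ‖g k‖ ^ 2)) • g n)) hx
    rw [← hrec] at hstep
    have hS : 0 ≤ ∑ k ∈ Finset.range n, ‖g k‖ ^ 2 := by positivity
    rw [Finset.sum_range_succ] at hstep
    rw [Finset.sum_range_succ, Finset.sum_range_succ]
    set S := ∑ k ∈ Finset.range n, ‖g k‖ ^ 2
    set s := √(δ + S)
    set s' := √(δ + (S + ‖g n‖ ^ 2)) with hs'
    have hs2 : s ^ 2 = δ + S := Real.sq_sqrt (by positivity)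
    have hs2' : s' ^ 2 = δ + (S + ‖g n‖ ^ 2) := Real.sq_sqrt (by positivity)
    have hs0 : 0 < s := Real.sqrt_pos.2 (by positivity)
    have hs0' : 0 < s' := Real.sqrt_pos.2 (by positivity)
    have hss : s ≤ s' := Real.sqrt_le_sqrt (by linarith [sq_nonneg ‖g n‖])
    rw [sub_right_comm, norm_sub_sq_real (w n - x), real_inner_smul_right, norm_smul,
      mul_pow, Real.norm_eq_abs, sq_abs, real_inner_comm] at hstep
    set I := inner ℝ (g n) (w n - x)
    have hG : ‖g n‖ ^ 2 = s' ^ 2 - s ^ 2 := by rw [hs2, hs2']; ring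
    rw [hG, div_pow, hα] at hstep
    have hmul := mul_le_mul_of_nonneg_left hstep hs0'.le
    have hq : s' * (‖w n - x‖ ^ 2 - 2 * (α / s' * I) +
        D ^ 2 / 2 / s' ^ 2 * (s' ^ 2 - s ^ 2)) =
        s' * ‖w n - x‖ ^ 2 - 2 * α * I + D ^ 2 / 2 * ((s' ^ 2 - s ^ 2) / s') := by
      field_simp
    have hr : (s' ^ 2 - s ^ 2) / s' ≤ 2 * (s' - s) := by
      rw [div_le_iff₀ hs0']
      nlinarith [sq_nonneg (s' - s)]
    have hr' := mul_le_mul_of_nonneg_left hr (show 0 ≤ D ^ 2 / 2 by positivity)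
    have hdd := mul_le_mul_of_nonneg_left (hd n) (sub_nonneg.2 hss)
    rw [hq] at hmul
    rw [mul_add]
    nlinarith

end Optimization

theorem le_cgcEnd {i : ℕ} : i ≤ cgcEnd i := by
  have : 0 < 2 ^ padicValNat 2 i := by positivity
  unfold cgcEnd
  omega

theorem mem_activeSet {t i : ℕ} : i ∈ activeSet t ↔ (1 ≤ i ∧ i ≤ t) ∧ t ≤ cgcEnd i := by
  simp [activeSet]

theorem self_mem_activeSet {t : ℕ} (ht : 1 ≤ t) : t ∈ activeSet t :=
  mem_activeSet.2 ⟨⟨ht, le_rfl⟩, le_cgcEnd⟩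

theorem activeSet_succ_subset (t : ℕ) : activeSet (t + 1) ⊆ insert (t + 1) (activeSet t) := by
  intro i hi
  rw [mem_activeSet] at hi
  rw [Finset.mem_insert, mem_activeSet]
  omega

theorem card_activeSet_le (t : ℕ) : (activeSet t).card ≤ t :=
  (Finset.card_filter_le _ _).trans (by simp)

/-- A quantity accumulated by each expert while it is active is the sum of its increments. -/
theorem eq_sum_Icc_of_activeSet_rec {A a : ℕ → ℕ → ℝ} (h0 : ∀ i ≥ 1, A (i - 1) i = 0)
    (hrec : ∀ t ≥ 1, ∀ i ∈ activeSet t, A t i = A (t - 1) i + a t i) {i t : ℕ} (hi : 1 ≤ i)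
    (hit : i ≤ t + 1) (ht : t ≤ cgcEnd i) : A t i = ∑ u ∈ Finset.Icc i t, a u i := by
  induction t with
  | zero =>
    obtain rfl : i = 1 := by omega
    simpa using h0 1 le_rfl
  | succ t ih =>
    rcases hit.eq_or_lt with h | h
    · subst h
      simpa using h0 (t + 1 + 1) hi
    · rw [hrec (t + 1) (by omega) i (mem_activeSet.2 ⟨⟨hi, by omega⟩, ht⟩), Nat.add_sub_cancel,
        ih (by omega) (by omega), Finset.sum_Icc_succ_top (by omega)]

/-- The total AdaNormalHedge potential of the active experts grows at most quadratically. -/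
theorem sum_anhPhi_activeSet_le {R C r : ℕ → ℕ → ℝ}
    (hR0 : ∀ i ≥ 1, R (i - 1) i = 0) (hC0 : ∀ i ≥ 1, C (i - 1) i = 0)
    (hR : ∀ t ≥ 1, ∀ i ∈ activeSet t, R t i = R (t - 1) i + r t i)
    (hC : ∀ t ≥ 1, ∀ i ∈ activeSet t, C t i = C (t - 1) i + |r t i|)
    (hr : ∀ t ≥ 1, ∀ i ∈ activeSet t, |r t i| ≤ 1)
    (hw : ∀ t ≥ 1, ∑ i ∈ activeSet t, anhWeight (R (t - 1) i) (C (t - 1) i) * r t i ≤ 0)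
    (t : ℕ) :
    ∑ i ∈ activeSet t, anhPhi (R t i) (C t i) ≤ t + 3 * (t * (t + 1)) / 2 := by
  induction t with
  | zero => simp [activeSet]
  | succ t ih =>
    have hstep : ∀ i ∈ activeSet (t + 1), anhPhi (R (t + 1) i) (C (t + 1) i) ≤
        anhPhi (R t i) (C t i) + anhWeight (R t i) (C t i) * r (t + 1) i + 3 := by
      intro i hi
      rw [hR (t + 1) (by omega) i hi, hC (t + 1) (by omega) i hi, Nat.add_sub_cancel]
      refine anhPhi_add_le ?_ (hr _ (by omega) i hi)
      rw [mem_activeSet] at hi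
      rw [eq_sum_Icc_of_activeSet_rec hR0 hR hi.1.1 hi.1.2 (by omega),
        eq_sum_Icc_of_activeSet_rec (a := fun t i => |r t i|) hC0 hC hi.1.1 hi.1.2 (by omega)]
      exact Finset.abs_sum_le_sum_abs _ _
    have hsum := Finset.sum_le_sum hstep
    rw [Finset.sum_add_distrib, Finset.sum_add_distrib, Finset.sum_const, nsmul_eq_mul] at hsum
    have hcard : ((activeSet (t + 1)).card : ℝ) ≤ (t : ℝ) + 1 := by
      exact_mod_cast card_activeSet_le (t + 1)
    have hw' := hw (t + 1) (by omega)
    rw [Nat.add_sub_cancel] at hw'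
    have hnew : anhPhi (R t (t + 1)) (C t (t + 1)) = 1 := by
      have h1 := hR0 (t + 1) (by omega)
      have h2 := hC0 (t + 1) (by omega)
      rw [Nat.add_sub_cancel] at h1 h2
      rw [h1, h2, anhPhi_zero_zero]
    have hold : ∑ i ∈ activeSet (t + 1), anhPhi (R t i) (C t i) ≤
        1 + ∑ i ∈ activeSet t, anhPhi (R t i) (C t i) := by
      have hnot : t + 1 ∉ activeSet t := by simp [mem_activeSet]
      rw [← hnew, ← Finset.sum_insert (f := fun i => anhPhi (R t i) (C t i)) hnot]
      exact Finset.sum_le_sum_of_subset_of_nonneg (activeSet_succ_subset t)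
        fun i _ _ => anhPhi_nonneg _ _
    push_cast
    linarith

theorem sq_le_of_anhPhi_le {R C B : ℝ} (hRC : |R| ≤ C) (hR : 0 ≤ R) (h : anhPhi R C ≤ B) :
    R ^ 2 ≤ 3 * C * Real.log B := by
  rcases ((abs_nonneg R).trans hRC).eq_or_lt with hC | hC
  · have : R = 0 := abs_nonpos_iff.1 (hRC.trans_eq hC.symm)
    simp [this, ← hC]
  · simp only [anhPhi, hC, if_true, max_eq_left hR] at h
    have := Real.log_le_log (Real.exp_pos _) h
    rw [Real.log_exp, div_le_iff₀ (by positivity)] at this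
    linarith

theorem total_regret_le {R Δ c h δ D H L M : ℝ} (hc : 0 ≤ c) (hD : 0 ≤ D) (hH : 0 ≤ H)
    (hδ : 0 ≤ δ) (hL : 0 ≤ L) (hM : 0 ≤ M) (hh : h = H * D ^ 2)
    (hΔ : Δ = M - L) (hreg : Δ ≤ D * √(2 * δ + 8 * H * M))
    (hR : 0 ≤ R → R ^ 2 ≤ 3 * c * (R + 2 * M)) :
    R + Δ ≤ 9 / 2 * c + 18 * h + 2 * D * √(2 * δ) + √((24 * c + 16 * h) * L) := by
  have hh0 : 0 ≤ h := by rw [hh]; positivity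
  set p := D * √(2 * δ) with hp
  have hp0 : 0 ≤ p := by positivity
  have hp2 : p ^ 2 = 2 * D ^ 2 * δ := by
    rw [hp, mul_pow, Real.sq_sqrt (by positivity)]; ring
  set q := √(8 * h * L)
  have hq0 : 0 ≤ q := Real.sqrt_nonneg _
  have hq2 : q ^ 2 = 8 * h * L := Real.sq_sqrt (by positivity)
  set n := √(12 * c * L)
  have hn0 : 0 ≤ n := Real.sqrt_nonneg _
  have hn2 : n ^ 2 = 12 * c * L := Real.sq_sqrt (by positivity)
  have hΔ' : Δ ≤ 8 * h + p + q := by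
    by_contra! hcon
    have hpos : 0 < Δ := by linarith
    have h1 : Δ ^ 2 ≤ (D * √(2 * δ + 8 * H * M)) ^ 2 := by gcongr
    rw [mul_pow, Real.sq_sqrt (by positivity)] at h1
    have h2 : Δ ^ 2 ≤ p ^ 2 + q ^ 2 + 8 * h * Δ := by
      rw [hp2, hq2, hh, hΔ] at *
      linarith
    nlinarith [mul_nonneg hp0 (show 0 ≤ Δ - p by linarith),
      mul_nonneg hq0 (show 0 ≤ Δ - q by linarith)]
  have hqL : q ≤ L + 2 * h := by
    refine abs_le_of_sq_le_sq' ?_ (by positivity) |>.2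
    nlinarith [sq_nonneg (L - 2 * h)]
  set v := 10 * h + p with hv
  have hv0 : 0 ≤ v := by positivity
  have hMv : M ≤ 2 * L + v := by linarith
  have hR' : R ≤ 9 / 2 * c + v + n := by
    by_contra! hcon
    have h1 := hR (by linarith)
    have h2 : 6 * c * M ≤ (n + 3 / 2 * c + v) ^ 2 := by
      have := mul_le_mul_of_nonneg_left hMv (show 0 ≤ 6 * c by positivity)
      nlinarith [sq_nonneg (3 / 2 * c - v), mul_nonneg hn0 hc, mul_nonneg hn0 hv0]
    nlinarith [mul_pos (show 0 < R - (9 / 2 * c + v + n) by linarith)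
      (show 0 < R - (9 / 2 * c + v + n) + 1 by linarith), mul_nonneg hc hn0, mul_nonneg hc hv0]
  have hnq : n + q ≤ √((24 * c + 16 * h) * L) := by
    refine Real.le_sqrt_of_sq_le ?_
    nlinarith [sq_nonneg (n - q)]
  linarith

/-- Regret of scale-free online gradient descent against self-bounding convex losses. -/
theorem sum_sub_le_of_scaleFree_ogd {E : Type*} [NormedAddCommGroup E] [InnerProductSpace ℝ E]
    [CompleteSpace E] {W : Set E} (hW : Convex ℝ W) {proj : E → E}
    (hproj : ∀ x : E, proj x ∈ W ∧ ∀ y ∈ W, ‖x - proj x‖ ≤ ‖x - y‖) {D : ℝ} (hD : 0 ≤ D)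
    (hdiam : ∀ x ∈ W, ∀ y ∈ W, ‖x - y‖ ≤ D) {f : ℕ → E → ℝ}
    (hconv : ∀ t, ConvexOn ℝ Set.univ (f t)) (hdiff : ∀ t, Differentiable ℝ (f t))
    (hnonneg : ∀ t, ∀ x : E, 0 ≤ f t x) {H : ℝ} (hH : 0 ≤ H)
    (hsmooth : ∀ t, ∀ x y : E, ‖gradient (f t) x - gradient (f t) y‖ ≤ H * ‖x - y‖)
    {δ : ℝ} (hδ : 0 < δ) {w : ℕ → E} (hw : ∀ n, w n ∈ W)
    (hrec : ∀ n, w (n + 1) = proj (w n - ((D / √2) /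
      √(δ + ∑ k ∈ Finset.range (n + 1), ‖gradient (f k) (w k)‖ ^ 2)) • gradient (f n) (w n)))
    {x : E} (hx : x ∈ W) (n : ℕ) :
    ∑ k ∈ Finset.range n, (f k (w k) - f k x) ≤
      D * √(2 * δ + 8 * H * ∑ k ∈ Finset.range n, f k (w k)) := by
  rcases hD.eq_or_lt with h0 | hDpos
  · have hwx : ∀ k, w k = x := fun k => by
      have := hdiam _ (hw k) _ hx
      rw [← h0, norm_le_zero_iff, sub_eq_zero] at this
      exact this
    simp [hwx, ← h0]
  · have hlin := mul_sum_inner_le_of_scaleFree_ogd hW hproj hdiam hδ (α := D / √2)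
      (by rw [div_pow, Real.sq_sqrt (by norm_num)]) (g := fun k => gradient (f k) (w k))
      hw hrec hx n
    have hreg : ∑ k ∈ Finset.range n, (f k (w k) - f k x) ≤
        ∑ k ∈ Finset.range n, inner ℝ (gradient (f k) (w k)) (w k - x) := by
      refine Finset.sum_le_sum fun k _ => ?_
      have := (hconv k).add_inner_gradient_le (hdiff k (w k)) x
      rw [← neg_sub (w k) x, inner_neg_right] at this
      linarith
    have hgrad : ∑ k ∈ Finset.range n, ‖gradient (f k) (w k)‖ ^ 2 ≤
        4 * H * ∑ k ∈ Finset.range n, f k (w k) := by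
      rw [Finset.mul_sum]
      exact Finset.sum_le_sum fun k _ =>
        (hconv k).norm_gradient_sq_le (hdiff k) (hnonneg k) hH (hsmooth k) (w k)
    have h2 : (0 : ℝ) < √2 := by positivity
    have hlin' : ∑ k ∈ Finset.range n, inner ℝ (gradient (f k) (w k)) (w k - x) ≤
        D * (√2 * √(δ + ∑ k ∈ Finset.range n, ‖gradient (f k) (w k)‖ ^ 2)) := by
      rw [div_mul_eq_mul_div, div_le_iff₀ h2] at hlin
      refine le_of_mul_le_mul_left ?_ hDpos
      linarith
    refine (hreg.trans hlin').trans (mul_le_mul_of_nonneg_left ?_ hD)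
    rw [← Real.sqrt_mul (by norm_num)]
    refine Real.sqrt_le_sqrt ?_
    linarith

theorem sum_Icc_add_eq_sum_range (F : ℕ → ℝ) (i n : ℕ) :
    ∑ u ∈ Finset.Icc i (i + n), F u = ∑ k ∈ Finset.range (n + 1), F (i + k) := by
  rw [← Finset.Ico_add_one_right_eq_Icc, Finset.sum_Ico_eq_sum_range]
  congr 2
  omega

/-- Lemma 2 (interval regret of SACS on CGC intervals): under Assumptions 1–4, with SOGD
experts (parameters `δ > 0`, `α = D/√2`) combined by the SACS meta-algorithm over the CGC
intervals, for any interval `[i, cgcEnd i] ∈ 𝒞`, any `t ∈ [i, cgcEnd i]`, and any `x ∈ W`: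
`Σ_{u=i}^t (f u (wA u) − f u x) ≤ a(t) + √(b(t) Σ_{u=i}^t f u x)`, where
`a(t) = (9/2) ln(4t²) + 18 H D² + 2D√(2δ)` and `b(t) = 24 ln(4t²) + 16 H D²`. -/
theorem stmt_3
    {E : Type*} [NormedAddCommGroup E] [InnerProductSpace ℝ E] [FiniteDimensional ℝ E]
    (W : Set E) (hWne : W.Nonempty) (hWclosed : IsClosed W) (hWconvex : Convex ℝ W)
    -- `proj` is the metric projection onto `W`
    (proj : E → E)
    (hproj : ∀ x : E, proj x ∈ W ∧ ∀ y ∈ W, ‖x - proj x‖ ≤ ‖x - y‖)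
    -- Assumption 1: the diameter of `W` is bounded by `D`
    (D : ℝ) (hdiam : ∀ x ∈ W, ∀ y ∈ W, ‖x - y‖ ≤ D)
    -- Assumption 2: the online functions are convex, differentiable and nonnegative on `E`
    (f : ℕ → E → ℝ)
    (hconv : ∀ t, ConvexOn ℝ Set.univ (f t))
    (hdiff : ∀ t, Differentiable ℝ (f t))
    (hnonneg : ∀ t, ∀ x : E, 0 ≤ f t x)
    -- Assumption 3: the online functions are `H`-smooth
    (H : ℝ) (hH : 0 ≤ H)
    (hsmooth : ∀ t, ∀ x y : E,
      ‖gradient (f t) x - gradient (f t) y‖ ≤ H * ‖x - y‖)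
    -- Assumption 4: the losses take values in `[0, 1]` on `W`
    (hbound : ∀ t, ∀ x ∈ W, f t x ∈ Set.Icc (0 : ℝ) 1)
    -- expert `E i` is an instance of SOGD (parameters `δ > 0`, `α = D/√2`) started at round `i`
    (δ : ℝ) (hδ : 0 < δ)
    (wE : ℕ → ℕ → E)
    (hwE_init : ∀ i ≥ 1, wE i i ∈ W)
    (hwE_rec : ∀ i ≥ 1, ∀ t ≥ i, wE (t + 1) i =
      proj (wE t i - ((D / Real.sqrt 2) /
        Real.sqrt (δ + ∑ u ∈ Finset.Icc i t, ‖gradient (f u) (wE u i)‖ ^ 2)) •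
          gradient (f t) (wE t i)))
    -- the SACS meta-algorithm
    (Rg Cg p : ℕ → ℕ → ℝ) (wA : ℕ → E)
    (hR0 : ∀ i ≥ 1, Rg (i - 1) i = 0)
    (hC0 : ∀ i ≥ 1, Cg (i - 1) i = 0)
    (hp : ∀ t ≥ 1, ∀ i ∈ activeSet t,
      p t i = anhWeight (Rg (t - 1) i) (Cg (t - 1) i)
        / ∑ j ∈ activeSet t, anhWeight (Rg (t - 1) j) (Cg (t - 1) j))
    (hwA : ∀ t ≥ 1, wA t = ∑ i ∈ activeSet t, p t i • wE t i)
    (hRrec : ∀ t ≥ 1, ∀ i ∈ activeSet t,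
      Rg t i = Rg (t - 1) i + f t (wA t) - f t (wE t i))
    (hCrec : ∀ t ≥ 1, ∀ i ∈ activeSet t,
      Cg t i = Cg (t - 1) i + |f t (wA t) - f t (wE t i)|)
    -- an interval `[i, cgcEnd i] ∈ 𝒞`, a round `t` in it, and a comparator `x ∈ W`
    (i t : ℕ) (hi : 1 ≤ i) (hit : i ≤ t) (hte : t ≤ cgcEnd i)
    (x : E) (hx : x ∈ W) :
    ∑ u ∈ Finset.Icc i t, (f u (wA u) - f u x)
      ≤ (9 / 2 * Real.log (4 * (t : ℝ) ^ 2) + 18 * H * D ^ 2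
            + 2 * D * Real.sqrt (2 * δ))
        + Real.sqrt ((24 * Real.log (4 * (t : ℝ) ^ 2) + 16 * H * D ^ 2)
            * ∑ u ∈ Finset.Icc i t, f u x) := by
  have hD : 0 ≤ D := (norm_nonneg _).trans (hdiam x hx x hx)
  have ht1 : 1 ≤ t := hi.trans hit
  have hwE : ∀ i ≥ 1, ∀ t ≥ i, wE t i ∈ W := by
    intro i hi t ht
    rcases ht.eq_or_lt with h | h
    · exact h ▸ hwE_init i hi
    · obtain ⟨s, rfl⟩ : ∃ s, t = s + 1 := ⟨t - 1, by omega⟩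
      rw [hwE_rec i hi s (by omega)]
      exact (hproj _).1
  have hwE_active : ∀ t, ∀ i ∈ activeSet t, wE t i ∈ W := fun t i h =>
    hwE i (mem_activeSet.1 h).1.1 t (mem_activeSet.1 h).1.2
  have hZ : ∀ t ≥ 1, 0 < ∑ j ∈ activeSet t, anhWeight (Rg (t - 1) j) (Cg (t - 1) j) := by
    intro t ht
    refine Finset.sum_pos' (fun j _ => anhWeight_nonneg _ _) ⟨t, self_mem_activeSet ht, ?_⟩
    rw [hR0 t ht, hC0 t ht]
    exact anhWeight_zero_zero_pos
  have hp0 : ∀ t ≥ 1, ∀ i ∈ activeSet t, 0 ≤ p t i := fun t ht i h => by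
    rw [hp t ht i h]
    exact div_nonneg (anhWeight_nonneg _ _) (hZ t ht).le
  have hp1 : ∀ t ≥ 1, ∑ i ∈ activeSet t, p t i = 1 := fun t ht => by
    rw [Finset.sum_congr rfl (hp t ht), ← Finset.sum_div, div_self (hZ t ht).ne']
  have hwA_mem : ∀ t ≥ 1, wA t ∈ W := fun t ht => by
    rw [hwA t ht]
    exact hWconvex.sum_mem (hp0 t ht) (hp1 t ht) (hwE_active t)
  have hjensen : ∀ t ≥ 1, f t (wA t) ≤ ∑ i ∈ activeSet t, p t i * f t (wE t i) :=
    fun t ht => by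
      rw [hwA t ht]
      simpa using (hconv t).map_sum_le (hp0 t ht) (hp1 t ht) fun i _ => Set.mem_univ (wE t i)
  have hw : ∀ t ≥ 1, ∑ i ∈ activeSet t, anhWeight (Rg (t - 1) i) (Cg (t - 1) i) *
      (f t (wA t) - f t (wE t i)) ≤ 0 := by
    intro t ht
    have hpw : ∀ i ∈ activeSet t, anhWeight (Rg (t - 1) i) (Cg (t - 1) i) *
        (f t (wA t) - f t (wE t i)) =
        (∑ j ∈ activeSet t, anhWeight (Rg (t - 1) j) (Cg (t - 1) j)) *
          (p t i * f t (wA t) - p t i * f t (wE t i)) := fun i h => by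
      rw [hp t ht i h]
      have := (hZ t ht).ne'
      field_simp
    rw [Finset.sum_congr rfl hpw, ← Finset.mul_sum, Finset.sum_sub_distrib, ← Finset.sum_mul,
      hp1 t ht, one_mul]
    exact mul_nonpos_of_nonneg_of_nonpos (hZ t ht).le (sub_nonpos.2 (hjensen t ht))
  have hR : ∀ t ≥ 1, ∀ i ∈ activeSet t,
      Rg t i = Rg (t - 1) i + (f t (wA t) - f t (wE t i)) := fun t ht i h => by
    rw [hRrec t ht i h, add_sub_assoc]
  have hr : ∀ t ≥ 1, ∀ i ∈ activeSet t, |f t (wA t) - f t (wE t i)| ≤ 1 := fun t ht i h => by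
    obtain ⟨h1, h2⟩ := hbound t _ (hwA_mem t ht)
    obtain ⟨h3, h4⟩ := hbound t _ (hwE_active t i h)
    rw [abs_le]
    constructor <;> linarith
  have htR : (1 : ℝ) ≤ t := by exact_mod_cast ht1
  have hphi : anhPhi (Rg t i) (Cg t i) ≤ 4 * (t : ℝ) ^ 2 := by
    have h1 := sum_anhPhi_activeSet_le hR0 hC0 hR hCrec hr hw t
    have h2 := Finset.single_le_sum (f := fun i => anhPhi (Rg t i) (Cg t i))
      (fun i _ => anhPhi_nonneg _ _) (mem_activeSet.2 ⟨⟨hi, hit⟩, hte⟩)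
    have h3 := h2.trans h1
    nlinarith
  have hRsum := eq_sum_Icc_of_activeSet_rec hR0 hR hi (by omega) hte
  have hCsum := eq_sum_Icc_of_activeSet_rec (a := fun t i => |f t (wA t) - f t (wE t i)|)
    hC0 hCrec hi (by omega) hte
  have hRC : |Rg t i| ≤ Cg t i := by
    rw [hRsum, hCsum]
    exact Finset.abs_sum_le_sum_abs _ _
  have hCM : Cg t i ≤ Rg t i + 2 * ∑ u ∈ Finset.Icc i t, f u (wE u i) := by
    rw [hRsum, hCsum, Finset.mul_sum, ← Finset.sum_add_distrib]
    refine Finset.sum_le_sum fun u hu => ?_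
    have h1 := hnonneg u (wA u)
    have h2 := hnonneg u (wE u i)
    rw [abs_le]
    constructor <;> linarith
  have hc : 0 ≤ Real.log (4 * (t : ℝ) ^ 2) := Real.log_nonneg (by nlinarith)
  have hreg : ∑ u ∈ Finset.Icc i t, f u (wE u i) - ∑ u ∈ Finset.Icc i t, f u x ≤
      D * √(2 * δ + 8 * H * ∑ u ∈ Finset.Icc i t, f u (wE u i)) := by
    obtain ⟨n, rfl⟩ := Nat.exists_eq_add_of_le hit
    rw [← Finset.sum_sub_distrib, sum_Icc_add_eq_sum_range, sum_Icc_add_eq_sum_range]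
    refine sum_sub_le_of_scaleFree_ogd hWconvex hproj hD hdiam (f := fun k => f (i + k))
      (w := fun k => wE (i + k) i) (fun k => hconv _) (fun k => hdiff _) (fun k => hnonneg _) hH
      (fun k => hsmooth _) hδ (fun k => hwE i hi _ (by omega)) (fun k => ?_) hx (n + 1)
    rw [← sum_Icc_add_eq_sum_range (fun u => ‖gradient (f u) (wE u i)‖ ^ 2)]
    exact hwE_rec i hi (i + k) (by omega)
  have hfinal := total_regret_le (R := Rg t i) hc hD hH hδ.le
    (Finset.sum_nonneg fun u _ => hnonneg u x)
    (Finset.sum_nonneg fun u _ => hnonneg u (wE u i)) rfl rfl hreg fun h0 => by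
      refine (sq_le_of_anhPhi_le hRC h0 hphi).trans ?_
      have := mul_le_mul_of_nonneg_left hCM hc
      linarith
  rw [hRsum, Finset.sum_sub_distrib] at hfinal
  rw [Finset.sum_sub_distrib, mul_assoc 18, mul_assoc 16]
  linarith
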